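/- arXiv:1508.05423 — 3 statements merged into one kernel-verified Lean document; each statement's English description precedes it below -/
import Mathlib

section
/- Assume t ↦ π^{(t)}(x) is non-decreasing for every x, the walk is uniformly lazy with parameter γ ∈ (0,1/2], and sup_{t,y} π^{(t)}(y) ≤ C < ∞. Fix d > 1 and α ∈ (0,1). Then there is a finite constant C′ = C′(d,α,γ,C) such that for every t ∈ ℕ with ψ_d(t) > 0 and all x ∈ V₀, y ∈ V, one has P(0,x;t,y) ≤ C′·ψ_d(t)^{−(1−α)d/2}. -/
open MeasureTheory

noncomputable section

namespace TimeVaryingConductances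

/-- Vertex conductance `π^{(t)}(x) = ∑_y π^{(t)}(x,y)`. -/
def vc {V : Type} (π : ℕ → V → V → ℝ) (t : ℕ) (x : V) : ℝ := ∑' y, π t x y

/-- `π^{(t)}(A) = ∑_{a ∈ A} π^{(t)}(a)` for a finite set `A`. -/
def fMass {V : Type} (π : ℕ → V → V → ℝ) (t : ℕ) (A : Finset V) : ℝ := ∑ a ∈ A, vc π t a

open Classical in
/-- `π^{(t)}(A, Aᶜ)` for a finite set `A`. -/
def fCut {V : Type} (π : ℕ → V → V → ℝ) (t : ℕ) (A : Finset V) : ℝ :=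
  ∑ a ∈ A, ∑' b, if b ∈ A then 0 else π t a b

/-- Isoperimetric constant `κ_u` of order `d`. -/
def kappa {V : Type} (π : ℕ → V → V → ℝ) (d : ℝ) (u : ℕ) : ℝ :=
  sInf {r : ℝ | ∃ A : Finset V, A.Nonempty ∧ (∀ a ∈ A, 0 < vc π u a) ∧
    r = fCut π u A / fMass π u A ^ ((d - 1) / d)}

/-- Isoperimetric growth function `ψ_d(t) = ∑_{u<t} κ_u²`. -/
def psi {V : Type} (π : ℕ → V → V → ℝ) (d : ℝ) (t : ℕ) : ℝ :=
  ∑ u ∈ Finset.range t, kappa π d u ^ 2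

/-- One-step transition probability `P(t,x;t+1,y) = π^{(t)}(x,y)/π^{(t)}(x)`. -/
def step {V : Type} (π : ℕ → V → V → ℝ) (t : ℕ) (x y : V) : ℝ := π t x y / vc π t x

open Classical in
/-- `n`-step transition probability starting at time `s` (Chapman–Kolmogorov). -/
def Pn {V : Type} (π : ℕ → V → V → ℝ) (s : ℕ) : ℕ → V → V → ℝ
  | 0 => fun x y => if x = y then 1 else 0
  | n + 1 => fun x y => ∑' z, Pn π s n x z * step π (s + n) z y

/-- Heat kernel `h(s,x;t,y) = P(s,x;t,y)/π^{(t)}(y)`. -/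
def hk {V : Type} (π : ℕ → V → V → ℝ) (s t : ℕ) (x y : V) : ℝ :=
  Pn π s (t - s) x y / vc π t y

/-- The set of ratios `π^{(u)}(x)/π^{(u+1)}(x)`, `x ∈ V_u`, whose supremum drives
the recursion `β(u+1) = β(u)·sup_{x∈V_u} π^{(u)}(x)/π^{(u+1)}(x)`. -/
def ratioSet {V : Type} (π : ℕ → V → V → ℝ) (u : ℕ) : Set ℝ :=
  {r : ℝ | ∃ x : V, 0 < vc π u x ∧ r = vc π u x / vc π (u + 1) x}

/-- The averaging operator `g ↦ P g` of the walk with conductances `p`. -/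
def avg {V : Type} (p : V → V → ℝ) (g : V → ℝ) (y : V) : ℝ := (∑' z, p y z * g z) / ∑' z, p y z

/-- The `L¹` norm of a non-negative function with respect to the vertex conductances. -/
def normOne {V : Type} (p : V → V → ℝ) (g : V → ℝ) : ℝ := ∑' y, (∑' z, p y z) * g y

/-- The squared `L²` norm with respect to the vertex conductances. -/
def normSq {V : Type} (p : V → V → ℝ) (g : V → ℝ) : ℝ := ∑' y, (∑' z, p y z) * g y ^ 2

/-- Non-negative, symmetric, locally finite edge conductances. -/
structure IsNetwork {V : Type} (p : V → V → ℝ) : Prop where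
  nonneg : ∀ x y, 0 ≤ p x y
  symm : ∀ x y, p x y = p y x
  finite : ∀ x, {y | p x y ≠ 0}.Finite

open Classical in
/-- A finite set together with its neighbours. -/
def IsNetwork.nbhd {V : Type} {p : V → V → ℝ} (h : IsNetwork p) (N : Finset V) : Finset V :=
  N ∪ N.biUnion fun x => (h.finite x).toFinset

lemma sq_sum_mul_le_of_lazy {ι : Type*} (s : Finset ι) (q g : ι → ℝ) {y : ι} (hy : y ∈ s)
    (hq : ∀ z ∈ s, 0 ≤ q z) {γ : ℝ} (hγ : γ * ∑ z ∈ s, q z ≤ q y) :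
    (∑ z ∈ s, q z * g z) ^ 2 ≤
      (∑ z ∈ s, q z) * (∑ z ∈ s, q z * g z ^ 2 - γ * ∑ z ∈ s, q z * (g z - g y) ^ 2) := by
  classical
  set M := ∑ z ∈ s, q z with hM
  set A₁ := ∑ z ∈ s, q z * (g z - g y) with hA₁
  set A₂ := ∑ z ∈ s, q z * (g z - g y) ^ 2 with hA₂
  have e1 : ∑ z ∈ s, q z * g z = A₁ + M * g y := by
    rw [hA₁, hM, Finset.sum_mul, ← Finset.sum_add_distrib]
    exact Finset.sum_congr rfl fun z _ => by ring
  have e2 : ∑ z ∈ s, q z * g z ^ 2 = A₂ + 2 * g y * A₁ + M * g y ^ 2 := by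
    rw [hA₁, hA₂, hM, Finset.sum_mul, Finset.mul_sum, ← Finset.sum_add_distrib,
      ← Finset.sum_add_distrib]
    exact Finset.sum_congr rfl fun z _ => by ring
  have hA₂0 : 0 ≤ A₂ := Finset.sum_nonneg fun z hz => mul_nonneg (hq z hz) (sq_nonneg _)
  have key : A₁ ^ 2 ≤ (M - q y) * A₂ := by
    have f1 : A₁ = ∑ z ∈ s.erase y, q z * (g z - g y) := by
      rw [hA₁, ← Finset.add_sum_erase s _ hy]; simp
    have f2 : A₂ = ∑ z ∈ s.erase y, q z * (g z - g y) ^ 2 := by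
      rw [hA₂, ← Finset.add_sum_erase s _ hy]; simp
    have f3 : M - q y = ∑ z ∈ s.erase y, q z := by
      rw [hM, ← Finset.add_sum_erase s _ hy]; ring
    rw [f1, f2, f3]
    have hq' : ∀ z ∈ s.erase y, 0 ≤ q z := fun z hz => hq z (Finset.mem_of_mem_erase hz)
    exact Finset.sum_sq_le_sum_mul_sum_of_sq_le_mul _ hq'
      (fun z hz => mul_nonneg (hq' z hz) (sq_nonneg _)) fun z _ => le_of_eq (by ring)
  rw [e1, e2]
  nlinarith [mul_le_mul_of_nonneg_right hγ hA₂0]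

/-- Discrete co-area inequality. -/
lemma coarea_le {V : Type} [DecidableEq V] (p : V → V → ℝ) (m F : V → ℝ)
    (N W : Finset V) {Φ : ℝ} (hF : ∀ x, 0 ≤ F x) (Ω : Finset V) (hΩN : Ω ⊆ N)
    (hΩ : ∀ x, x ∈ Ω ↔ 0 < F x)
    (hcut : ∀ A ⊆ Ω, Φ * ∑ a ∈ A, m a ≤ ∑ a ∈ A, ∑ b ∈ W \ A, p a b) :
    Φ * ∑ x ∈ N, m x * F x ≤ ∑ x ∈ N, ∑ y ∈ W, p x y * max (F x - F y) 0 := by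
  induction hn : Ω.card using Nat.strong_induction_on generalizing F Ω with
  | _ n ih =>
  have hF0 : ∀ x, x ∉ Ω → F x = 0 := fun x hx =>
    le_antisymm (not_lt.1 fun h => hx ((hΩ x).2 h)) (hF x)
  rcases Ω.eq_empty_or_nonempty with rfl | hne
  · have : ∀ x, F x = 0 := fun x => hF0 x (by simp)
    simp [this]
  obtain ⟨x₀, hx₀, hmin⟩ := Ω.exists_min_image F hne
  set a := F x₀ with ha
  have ha0 : 0 < a := (hΩ x₀).1 hx₀
  let F' : V → ℝ := fun x => if x ∈ Ω then F x - a else 0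
  let Ω' := Ω.filter fun x => a < F x
  have hsub : Ω' ⊆ Ω := Finset.filter_subset _ _
  have hlt : Ω'.card < n := by
    rw [← hn]
    exact Finset.card_lt_card (Finset.filter_ssubset.2 ⟨x₀, hx₀, by simp [ha]⟩)
  have hI := ih _ hlt F' (fun x => by
      by_cases hx : x ∈ Ω
      · simpa [F', hx] using hmin x hx
      · simp [F', hx]) Ω' (hsub.trans hΩN) (fun x => by
      by_cases hx : x ∈ Ω <;> simp [F', Ω', hx])
      (fun A hA => hcut A (hA.trans hsub)) rfl
  have e1 : ∑ x ∈ N, m x * F x = a * ∑ x ∈ Ω, m x + ∑ x ∈ N, m x * F' x := by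
    rw [← Finset.sum_subset hΩN (fun x _ hx => by simp [hF0 x hx]),
      ← Finset.sum_subset hΩN (f := fun x => m x * F' x) (fun x _ hx => by simp [F', hx]),
      Finset.mul_sum, ← Finset.sum_add_distrib]
    exact Finset.sum_congr rfl fun x hx => by simp only [F', hx, if_true]; ring
  have e2 : ∑ x ∈ N, ∑ y ∈ W, p x y * max (F x - F y) 0 =
      a * ∑ x ∈ Ω, ∑ y ∈ W \ Ω, p x y + ∑ x ∈ N, ∑ y ∈ W, p x y * max (F' x - F' y) 0 := by
    have hF'0 : ∀ x, 0 ≤ F' x := fun x => by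
      by_cases hx : x ∈ Ω
      · simpa [F', hx] using hmin x hx
      · simp [F', hx]
    rw [← Finset.sum_subset hΩN (fun x _ hx => Finset.sum_eq_zero fun y _ => by
        simp [hF0 x hx, hF y]),
      ← Finset.sum_subset hΩN (f := fun x => ∑ y ∈ W, p x y * max (F' x - F' y) 0)
        (fun x _ hx => Finset.sum_eq_zero fun y _ => by
          have : F' x = 0 := by simp [F', hx]
          simp [this, hF'0 y]),
      Finset.mul_sum, ← Finset.sum_add_distrib]
    refine Finset.sum_congr rfl fun x hx => ?_
    have : ∑ y ∈ W \ Ω, p x y = ∑ y ∈ W, if y ∈ Ω then 0 else p x y := by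
      rw [← Finset.filter_notMem_eq_sdiff, Finset.sum_filter]
      exact Finset.sum_congr rfl fun y _ => by by_cases hy : y ∈ Ω <;> simp [hy]
    rw [this, Finset.mul_sum, ← Finset.sum_add_distrib]
    refine Finset.sum_congr rfl fun y _ => ?_
    by_cases hy : y ∈ Ω
    · simp [F', hx, hy]
    · have h1 : F y = 0 := hF0 y hy
      have h2 : F' y = 0 := by simp [F', hy]
      have h3 : F' x = F x - a := by simp [F', hx]
      have h4 := hmin x hx
      rw [h1, h2, h3, if_neg hy, sub_zero, sub_zero, max_eq_left (hF x),
        max_eq_left (by linarith)]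
      ring
  rw [e1, e2]
  nlinarith [mul_le_mul_of_nonneg_left (hcut Ω subset_rfl) ha0.le]

/-- Cheeger's inequality for functions supported where the isoperimetric ratio is at least `Φ`. -/
lemma cheeger {V : Type} [DecidableEq V] (p : V → V → ℝ) (hp : ∀ x y, 0 ≤ p x y)
    (hsymm : ∀ x y, p x y = p y x) (m h : V → ℝ) (N W : Finset V) (hNW : N ⊆ W)
    (hm : ∀ x ∈ N, m x = ∑ y ∈ W, p x y) {Φ : ℝ} (hΦ : 0 ≤ Φ) (hh : ∀ x, 0 ≤ h x)
    (Ω : Finset V) (hΩN : Ω ⊆ N) (hΩ : ∀ x, x ∈ Ω ↔ 0 < h x)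
    (hcut : ∀ A ⊆ Ω, Φ * ∑ a ∈ A, m a ≤ ∑ a ∈ A, ∑ b ∈ W \ A, p a b) :
    Φ ^ 2 * ∑ x ∈ N, m x * h x ^ 2 ≤ 4 * ∑ x ∈ N, ∑ y ∈ W, p x y * (h x - h y) ^ 2 := by
  set S := ∑ x ∈ N, m x * h x ^ 2 with hS
  set E := ∑ x ∈ N, ∑ y ∈ W, p x y * (h x - h y) ^ 2 with hE
  have hE0 : 0 ≤ E := Finset.sum_nonneg fun x _ => Finset.sum_nonneg fun y _ =>
    mul_nonneg (hp x y) (sq_nonneg _)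
  have hS0 : 0 ≤ S := Finset.sum_nonneg fun x hx => mul_nonneg
    (by rw [hm x hx]; exact Finset.sum_nonneg fun y _ => hp x y) (sq_nonneg _)
  have h1 : Φ * S ≤ ∑ x ∈ N, ∑ y ∈ W, p x y * (|h x - h y| * (h x + h y)) := by
    refine (coarea_le p m (fun x => h x ^ 2) N W (fun x => sq_nonneg _) Ω hΩN
      (fun x => ?_) hcut).trans ?_
    · rw [hΩ, sq_pos_iff]
      exact ⟨ne_of_gt, fun h' => lt_of_le_of_ne (hh x) (Ne.symm h')⟩
    · refine Finset.sum_le_sum fun x _ => Finset.sum_le_sum fun y _ =>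
        mul_le_mul_of_nonneg_left (max_le ?_ ?_) (hp x y)
      · nlinarith [le_abs_self (h x - h y), hh x, hh y]
      · exact mul_nonneg (abs_nonneg _) (add_nonneg (hh x) (hh y))
  have h2 : (∑ x ∈ N, ∑ y ∈ W, p x y * (|h x - h y| * (h x + h y))) ^ 2 ≤
      E * ∑ x ∈ N, ∑ y ∈ W, p x y * (h x + h y) ^ 2 := by
    rw [hE, ← Finset.sum_product', ← Finset.sum_product', ← Finset.sum_product']
    refine Finset.sum_sq_le_sum_mul_sum_of_sq_le_mul _
      (fun z _ => mul_nonneg (hp _ _) (sq_nonneg _))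
      (fun z _ => mul_nonneg (hp _ _) (sq_nonneg _)) fun z _ => ?_
    rw [mul_pow, mul_pow, sq_abs]
    exact le_of_eq (by ring)
  have h3 : ∑ x ∈ N, ∑ y ∈ W, p x y * (h x + h y) ^ 2 ≤ 4 * S := by
    have g1 : ∑ x ∈ N, ∑ y ∈ W, p x y * h x ^ 2 = S :=
      Finset.sum_congr rfl fun x hx => by rw [hm x hx, Finset.sum_mul]
    have g2 : ∑ x ∈ N, ∑ y ∈ W, p x y * h y ^ 2 ≤ S := by
      rw [Finset.sum_comm, ← Finset.sum_subset hNW]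
      · refine Finset.sum_le_sum fun y hy => ?_
        rw [hm y hy, ← Finset.sum_mul]
        refine mul_le_mul_of_nonneg_right ?_ (sq_nonneg _)
        rw [Finset.sum_congr rfl fun x _ => hsymm x y]
        exact Finset.sum_le_sum_of_subset_of_nonneg hNW fun x _ _ => hp y x
      · intro y _ hy
        have : h y = 0 := le_antisymm (not_lt.1 fun h' => hy (hΩN ((hΩ y).2 h'))) (hh y)
        simp [this]
    calc ∑ x ∈ N, ∑ y ∈ W, p x y * (h x + h y) ^ 2
        ≤ ∑ x ∈ N, ∑ y ∈ W, (2 * (p x y * h x ^ 2) + 2 * (p x y * h y ^ 2)) :=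
          Finset.sum_le_sum fun x _ => Finset.sum_le_sum fun y _ => by
            nlinarith [mul_nonneg (hp x y) (sq_nonneg (h x - h y))]
      _ = 2 * S + 2 * ∑ x ∈ N, ∑ y ∈ W, p x y * h y ^ 2 := by
          simp only [Finset.sum_add_distrib, ← Finset.mul_sum, g1]
      _ ≤ 4 * S := by linarith
  have h4 : (Φ * S) ^ 2 ≤ E * (4 * S) :=
    (pow_le_pow_left₀ (mul_nonneg hΦ hS0) h1 2).trans
      (h2.trans (mul_le_mul_of_nonneg_left h3 hE0))
  rcases hS0.eq_or_lt with h0 | h0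
  · rw [← h0]; linarith
  · refine le_of_mul_le_mul_right ?_ h0
    nlinarith

namespace IsNetwork

variable {V : Type} {p : V → V → ℝ}

lemma subset_nbhd (h : IsNetwork p) (N : Finset V) : N ⊆ h.nbhd N :=
  by classical exact Finset.subset_union_left

lemma mem_nbhd (h : IsNetwork p) {N : Finset V} {x y : V} (hx : x ∈ N) (hxy : p x y ≠ 0) :
    y ∈ h.nbhd N :=
  by classical exact Finset.mem_union_right _ (Finset.mem_biUnion.2 ⟨x, hx, by simpa using hxy⟩)

lemma tsum_row (h : IsNetwork p) {N : Finset V} {x : V} (hx : x ∈ N) :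
    ∑' y, p x y = ∑ y ∈ h.nbhd N, p x y :=
  tsum_eq_sum fun _ hy => not_not.1 fun h' => hy (h.mem_nbhd hx h')

lemma tsum_row_mul (h : IsNetwork p) (f : V → ℝ) {N : Finset V} {x : V} (hx : x ∈ N) :
    ∑' y, p x y * f y = ∑ y ∈ h.nbhd N, p x y * f y :=
  tsum_eq_sum fun _ hy => mul_eq_zero_of_left (not_not.1 fun h' => hy (h.mem_nbhd hx h')) _

lemma mass_nonneg (h : IsNetwork p) (x : V) : 0 ≤ ∑' y, p x y := tsum_nonneg (h.nonneg x)

lemma summable_row (h : IsNetwork p) (x : V) : Summable (p x) :=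
  summable_of_hasFiniteSupport (h.finite x)

lemma eq_zero_of_mass_eq_zero (h : IsNetwork p) {x : V} (hx : ∑' y, p x y = 0) (y : V) :
    p x y = 0 :=
  le_antisymm (hx ▸ (h.summable_row x).le_tsum y fun z _ => h.nonneg x z) (h.nonneg x y)

lemma avg_eq_zero (h : IsNetwork p) {g : V → ℝ} {B : Finset V} (hg : ∀ x ∉ B, g x = 0) {y : V}
    (hy : y ∉ h.nbhd B) : avg p g y = 0 := by
  have : ∀ z, p y z * g z = 0 := fun z => by
    by_cases hz : z ∈ B
    · refine mul_eq_zero_of_left (not_not.1 fun h' => hy (h.mem_nbhd hz ?_)) _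
      rwa [h.symm]
    · simp [hg z hz]
  simp [avg, this]

lemma mass_mul_avg (h : IsNetwork p) (g : V → ℝ) (y : V) :
    (∑' z, p y z) * avg p g y = ∑' z, p y z * g z := by
  by_cases hy : ∑' z, p y z = 0
  · simp [h.eq_zero_of_mass_eq_zero hy]
  · rw [avg, mul_div_cancel₀ _ hy]

lemma avg_nonneg (h : IsNetwork p) {g : V → ℝ} (hg : ∀ x, 0 ≤ g x) (y : V) : 0 ≤ avg p g y :=
  div_nonneg (tsum_nonneg fun z => mul_nonneg (h.nonneg y z) (hg z)) (h.mass_nonneg y)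

lemma normOne_eq (g : V → ℝ) {B : Finset V} (hg : ∀ x ∉ B, g x = 0) :
    normOne p g = ∑ y ∈ B, (∑' z, p y z) * g y :=
  tsum_eq_sum fun y hy => by simp [hg y hy]

lemma normSq_eq (g : V → ℝ) {B : Finset V} (hg : ∀ x ∉ B, g x = 0) :
    normSq p g = ∑ y ∈ B, (∑' z, p y z) * g y ^ 2 :=
  tsum_eq_sum fun y hy => by simp [hg y hy]

lemma sum_sum_mul (h : IsNetwork p) (f : V → ℝ) {B : Finset V} (hf : ∀ x ∉ B, f x = 0) :
    ∑ y ∈ h.nbhd B, ∑ z ∈ h.nbhd (h.nbhd B), p y z * f z = ∑ z ∈ B, (∑' y, p z y) * f z := by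
  rw [Finset.sum_comm, ← Finset.sum_subset ((h.subset_nbhd B).trans (h.subset_nbhd _))]
  · refine Finset.sum_congr rfl fun z hz => ?_
    rw [h.tsum_row hz, Finset.sum_mul]
    exact Finset.sum_congr rfl fun y _ => by rw [h.symm]
  · intro z _ hz
    simp [hf z hz]

lemma normOne_avg (h : IsNetwork p) {g : V → ℝ} (hg : g.support.Finite) :
    normOne p (avg p g) = normOne p g := by
  have hB : ∀ x ∉ hg.toFinset, g x = 0 := fun x hx => by simpa using hx
  rw [normOne_eq g hB, normOne_eq _ fun y hy => h.avg_eq_zero hB hy, ← h.sum_sum_mul g hB]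
  exact Finset.sum_congr rfl fun y hy => by rw [h.mass_mul_avg, h.tsum_row_mul g hy]

lemma support_avg_finite (h : IsNetwork p) {g : V → ℝ} (hg : g.support.Finite) :
    (avg p g).support.Finite :=
  (h.nbhd hg.toFinset).finite_toSet.subset fun y hy => by
    by_contra h'
    exact hy (h.avg_eq_zero (B := hg.toFinset) (fun x hx => by simpa using hx) h')

lemma normSq_avg_add_le (h : IsNetwork p) {γ : ℝ} (hγ : ∀ x, γ * ∑' y, p x y ≤ p x x)
    {g : V → ℝ} {B : Finset V} (hg : ∀ x ∉ B, g x = 0) :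
    normSq p (avg p g) +
      γ * ∑ y ∈ h.nbhd B, ∑ z ∈ h.nbhd (h.nbhd B), p y z * (g z - g y) ^ 2 ≤ normSq p g := by
  rw [normSq_eq g hg, normSq_eq _ fun y hy => h.avg_eq_zero hg hy,
    ← h.sum_sum_mul (fun z => g z ^ 2) fun x hx => by simp [hg x hx], Finset.mul_sum,
    ← Finset.sum_add_distrib]
  refine Finset.sum_le_sum fun y hy => ?_
  rw [← le_sub_iff_add_le]
  by_cases hm : ∑' z, p y z = 0
  · simp [h.eq_zero_of_mass_eq_zero hm]
  have hm' : 0 < ∑' z, p y z := lt_of_le_of_ne (h.mass_nonneg y) (Ne.symm hm)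
  have := sq_sum_mul_le_of_lazy (h.nbhd (h.nbhd B)) (p y) g (h.subset_nbhd _ hy)
    (fun z _ => h.nonneg y z) (by rw [← h.tsum_row hy]; exact hγ y)
  rw [← h.tsum_row hy, ← h.tsum_row_mul g hy, ← h.mass_mul_avg] at this
  refine le_of_mul_le_mul_left ?_ hm'
  linarith

open Classical in
lemma sum_cut_eq (h : IsNetwork p) {A N : Finset V} (hA : A ⊆ N) :
    (∑ a ∈ A, ∑' b, if b ∈ A then 0 else p a b) = ∑ a ∈ A, ∑ b ∈ h.nbhd N \ A, p a b := by
  refine Finset.sum_congr rfl fun a ha => ?_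
  rw [tsum_eq_sum (s := h.nbhd N \ A)]
  · exact Finset.sum_congr rfl fun b hb => if_neg (Finset.mem_sdiff.1 hb).2
  · intro b hb
    split_ifs with hbA
    · rfl
    · exact not_not.1 fun h' => hb (Finset.mem_sdiff.2 ⟨h.mem_nbhd (hA ha) h', hbA⟩)

/-- Nash-type contraction of the squared `L²` norm under one step of a lazy walk. -/
lemma normSq_avg_le (h : IsNetwork p) {γ : ℝ} (hγ0 : 0 < γ)
    (hγ : ∀ x, γ * ∑' y, p x y ≤ p x x) {d K L : ℝ} (hd : 1 < d) (hK : 0 ≤ K) (hL : 0 < L)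
    (hiso : ∀ A : Finset V, (∑ a ∈ A, ∑' y, p a y) ^ ((d - 1) / d) * K ≤
      ∑ a ∈ A, ∑' b, open Classical in if b ∈ A then 0 else p a b)
    {g : V → ℝ} (hg0 : ∀ x, 0 ≤ g x) (hg : g.support.Finite) (hgL : normOne p g ≤ L) :
    normSq p (avg p g) ≤
      normSq p g * (1 - γ / 8 * K ^ 2 * (normSq p g / (4 * L ^ 2)) ^ (2 / d)) := by
  classical
  set B := hg.toFinset
  have hB : ∀ x ∉ B, g x = 0 := fun x hx => by simpa [B] using hx
  set N := h.nbhd B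
  have hN : ∀ x ∉ N, g x = 0 := fun x hx => hB x fun h' => hx (h.subset_nbhd B h')
  have hc := h.normSq_avg_add_le hγ hB
  have hE0 : 0 ≤ ∑ y ∈ N, ∑ z ∈ h.nbhd N, p y z * (g z - g y) ^ 2 :=
    Finset.sum_nonneg fun x _ => Finset.sum_nonneg fun y _ =>
      mul_nonneg (h.nonneg x y) (sq_nonneg _)
  have hY0 : 0 ≤ normSq p g := tsum_nonneg fun x => mul_nonneg (h.mass_nonneg x) (sq_nonneg _)
  rcases hY0.eq_or_lt with hY | hY
  · rw [← hY] at hc ⊢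
    nlinarith [mul_nonneg hγ0.le hE0]
  set Y := normSq p g with hYdef
  have hYN : Y = ∑ y ∈ N, (∑' z, p y z) * g y ^ 2 := normSq_eq g hN
  have hON : normOne p g = ∑ y ∈ N, (∑' z, p y z) * g y := normOne_eq g hN
  set l := Y / (4 * L) with hl
  have hl0 : 0 < l := by positivity
  set f : V → ℝ := fun x => max (g x - l) 0
  set Ω := N.filter fun x => l < g x
  have hΩN : Ω ⊆ N := Finset.filter_subset _ _
  have hΩ : ∀ x, x ∈ Ω ↔ 0 < f x := fun x => by
    simp only [Ω, f, Finset.mem_filter, lt_max_iff, sub_pos, lt_irrefl, or_false,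
      and_iff_right_iff_imp]
    intro hx
    by_contra h'
    rw [hN x h'] at hx
    linarith
  have hΩm : ∑ x ∈ Ω, ∑' y, p x y ≤ 4 * L ^ 2 / Y := by
    have : (∑ x ∈ Ω, ∑' y, p x y) * l ≤ L := by
      refine le_trans ?_ hgL
      rw [hON, Finset.sum_mul]
      refine (Finset.sum_le_sum fun x hx => mul_le_mul_of_nonneg_left
        (Finset.mem_filter.1 hx).2.le (h.mass_nonneg x)).trans
        (Finset.sum_le_sum_of_subset_of_nonneg hΩN fun x _ _ =>
          mul_nonneg (h.mass_nonneg x) (hg0 x))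
    rw [← le_div_iff₀ hl0] at this
    have e : L / l = 4 * L ^ 2 / Y := by rw [hl]; field_simp
    rwa [e] at this
  set Q := Y / (4 * L ^ 2) with hQ
  have hQ0 : 0 < Q := by positivity
  have hcut : ∀ A ⊆ Ω, K * Q ^ (1 / d) * ∑ a ∈ A, ∑' y, p a y ≤
      ∑ a ∈ A, ∑ b ∈ h.nbhd N \ A, p a b := by
    intro A hA
    rw [← h.sum_cut_eq (hA.trans hΩN)]
    refine le_trans ?_ (hiso A)
    have hm0 : 0 ≤ ∑ a ∈ A, ∑' y, p a y := Finset.sum_nonneg fun a _ => h.mass_nonneg a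
    set M := ∑ a ∈ A, ∑' y, p a y
    rcases hm0.eq_or_lt with h0 | h0
    · rw [← h0, mul_zero]
      exact mul_nonneg (Real.rpow_nonneg le_rfl _) hK
    have hMQ : M * Q ≤ 1 := by
      have : M ≤ 4 * L ^ 2 / Y := (Finset.sum_le_sum_of_subset_of_nonneg hA
        fun x _ _ => h.mass_nonneg x).trans hΩm
      rw [hQ, ← le_div_iff₀ hQ0]
      rwa [one_div_div]
    have e : M = M ^ ((d - 1) / d) * M ^ (1 / d) := by
      rw [← Real.rpow_add h0, ← add_div, sub_add_cancel, div_self (by linarith), Real.rpow_one]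
    calc K * Q ^ (1 / d) * M = M ^ ((d - 1) / d) * K * (M * Q) ^ (1 / d) := by
          rw [Real.mul_rpow h0.le hQ0.le]
          nth_rewrite 1 [e]
          ring
      _ ≤ M ^ ((d - 1) / d) * K * 1 := by
          gcongr
          exact Real.rpow_le_one (by positivity) hMQ (by positivity)
      _ = _ := mul_one _
  have hch := cheeger p h.nonneg h.symm (fun x => ∑' y, p x y) f N (h.nbhd N) (h.subset_nbhd N)
    (fun x hx => h.tsum_row hx) (Φ := K * Q ^ (1 / d)) (by positivity)
    (fun x => le_max_right _ _) Ω hΩN hΩ hcut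
  have hfE : ∑ x ∈ N, ∑ y ∈ h.nbhd N, p x y * (f x - f y) ^ 2 ≤
      ∑ y ∈ N, ∑ z ∈ h.nbhd N, p y z * (g z - g y) ^ 2 := by
    refine Finset.sum_le_sum fun x _ => Finset.sum_le_sum fun y _ =>
      mul_le_mul_of_nonneg_left ?_ (h.nonneg x y)
    rw [sub_sq_comm (g y), sq_le_sq]
    have := abs_max_sub_max_le_abs (g x - l) (g y - l) 0
    rwa [sub_sub_sub_cancel_right] at this
  have hfY : Y / 2 ≤ ∑ x ∈ N, (∑' y, p x y) * f x ^ 2 := by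
    have : Y - 2 * l * normOne p g ≤ ∑ x ∈ N, (∑' y, p x y) * f x ^ 2 := by
      rw [hYN, hON, Finset.mul_sum, ← Finset.sum_sub_distrib]
      refine Finset.sum_le_sum fun x _ => ?_
      have hf : g x ^ 2 - 2 * l * g x ≤ f x ^ 2 := by
        rcases le_total l (g x) with hx | hx
        · simp only [f, max_eq_left (sub_nonneg.2 hx)]
          nlinarith
        · simp only [f, max_eq_right (sub_nonpos.2 hx)]
          nlinarith [hg0 x]
      nlinarith [mul_le_mul_of_nonneg_left hf (h.mass_nonneg x)]
    have h2 : 2 * l * normOne p g ≤ 2 * l * L := by gcongr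
    have h3 : 2 * l * L = Y / 2 := by rw [hl]; field_simp; norm_num
    linarith
  have hQd : (K * Q ^ (1 / d)) ^ 2 = K ^ 2 * Q ^ (2 / d) := by
    rw [mul_pow, ← Real.rpow_natCast (Q ^ (1 / d)), ← Real.rpow_mul hQ0.le]
    congr 2
    push_cast
    ring
  rw [hQd] at hch
  have h5 : K ^ 2 * Q ^ (2 / d) * (Y / 2) ≤
      4 * ∑ y ∈ N, ∑ z ∈ h.nbhd N, p y z * (g z - g y) ^ 2 :=
    (mul_le_mul_of_nonneg_left hfY (by positivity)).trans
      (hch.trans (mul_le_mul_of_nonneg_left hfE (by norm_num)))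
  nlinarith [mul_le_mul_of_nonneg_left h5 hγ0.le]

lemma normSq_nonneg (h : IsNetwork p) (g : V → ℝ) : 0 ≤ normSq p g :=
  tsum_nonneg fun x => mul_nonneg (h.mass_nonneg x) (sq_nonneg _)

/-- The decay `‖g‖₂^{4/d} ≤ 1/S` improves by a multiple of `K²` in one step of the walk. -/
lemma normSq_avg_rpow_mul_le (h : IsNetwork p) {γ : ℝ} (hγ0 : 0 < γ)
    (hγ : ∀ x, γ * ∑' y, p x y ≤ p x x) {d K L S : ℝ} (hd : 1 < d) (hK : 0 ≤ K) (hL : 0 < L)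
    (hiso : ∀ A : Finset V, (∑ a ∈ A, ∑' y, p a y) ^ ((d - 1) / d) * K ≤
      ∑ a ∈ A, ∑' b, open Classical in if b ∈ A then 0 else p a b)
    {g : V → ℝ} (hg0 : ∀ x, 0 ≤ g x) (hg : g.support.Finite) (hgL : normOne p g ≤ L)
    (hS : 0 ≤ S) (hgS : normSq p g ^ (2 / d) * S ≤ 1) :
    normSq p (avg p g) ^ (2 / d) * (S + γ / (4 * d) / (4 * L ^ 2) ^ (2 / d) * K ^ 2) ≤ 1 := by
  have hstep := h.normSq_avg_le hγ0 hγ hd hK hL hiso hg0 hg hgL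
  have hY0 := h.normSq_nonneg g
  have hY0' := h.normSq_nonneg (avg p g)
  set Y := normSq p g
  rw [Real.div_rpow hY0 (by positivity)] at hstep
  set R := (4 * L ^ 2) ^ (2 / d)
  have hR : 0 < R := by positivity
  set e := γ / (4 * d) / R * K ^ 2 with he
  have he0 : 0 ≤ e := by positivity
  have h1 : normSq p (avg p g) ≤ Y * Real.exp (-(γ / 8 * K ^ 2 * (Y ^ (2 / d) / R))) := by
    refine hstep.trans (mul_le_mul_of_nonneg_left ?_ hY0)
    linarith [Real.add_one_le_exp (-(γ / 8 * K ^ 2 * (Y ^ (2 / d) / R)))]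
  have h2 : normSq p (avg p g) ^ (2 / d) ≤ Y ^ (2 / d) * Real.exp (-(e * Y ^ (2 / d))) := by
    refine (Real.rpow_le_rpow hY0' h1 (by positivity)).trans (le_of_eq ?_)
    rw [Real.mul_rpow hY0 (Real.exp_pos _).le, ← Real.exp_mul, he]
    congr 2
    field_simp
    ring
  set Z := Y ^ (2 / d)
  have hZ : 0 ≤ Z := Real.rpow_nonneg hY0 _
  calc normSq p (avg p g) ^ (2 / d) * (S + e)
      ≤ Z * Real.exp (-(e * Z)) * (S + e) := by gcongr
    _ = (Z * S + e * Z) * Real.exp (-(e * Z)) := by ring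
    _ ≤ (e * Z + 1) * Real.exp (-(e * Z)) := 
        mul_le_mul_of_nonneg_right (by linarith) (Real.exp_pos _).le
    _ ≤ Real.exp (e * Z) * Real.exp (-(e * Z)) := by
        gcongr
        exact Real.add_one_le_exp _
    _ = 1 := by rw [← Real.exp_add, add_neg_cancel, Real.exp_zero]

end IsNetwork

namespace IsNetwork

variable {V : Type} {p q : V → V → ℝ}

lemma summable_mul {f m : V → ℝ} (hf : f.support.Finite) : Summable fun x => m x * f x :=
  summable_of_hasFiniteSupport (hf.subset fun _ hx => right_ne_zero_of_mul hx)

lemma summable_mul_sq {f m : V → ℝ} (hf : f.support.Finite) : Summable fun x => m x * f x ^ 2 :=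
  summable_of_hasFiniteSupport (hf.subset fun _ hx => pow_ne_zero_iff two_ne_zero |>.1
    (right_ne_zero_of_mul hx))

lemma normOne_mono {f : V → ℝ} (hpq : ∀ x, ∑' y, p x y ≤ ∑' y, q x y) (hf0 : ∀ x, 0 ≤ f x)
    (hf : f.support.Finite) : normOne p f ≤ normOne q f :=
  (summable_mul hf).tsum_le_tsum (fun x => mul_le_mul_of_nonneg_right (hpq x) (hf0 x))
    (summable_mul hf)

lemma normSq_mono {f : V → ℝ} (hpq : ∀ x, ∑' y, p x y ≤ ∑' y, q x y)
    (hf : f.support.Finite) : normSq p f ≤ normSq q f :=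
  (summable_mul_sq hf).tsum_le_tsum (fun x => mul_le_mul_of_nonneg_right (hpq x) (sq_nonneg _))
    (summable_mul_sq hf)

lemma support_reweight_finite {f m m' : V → ℝ} (hf : f.support.Finite) :
    (fun x => m x * f x / m' x).support.Finite :=
  hf.subset fun x hx => by
    simp only [Function.mem_support] at hx ⊢
    rintro h
    simp [h] at hx

lemma normOne_reweight_le (hp : IsNetwork p) {f : V → ℝ} (hf0 : ∀ x, 0 ≤ f x)
    (hf : f.support.Finite) :
    normOne q (fun x => (∑' y, p x y) * f x / ∑' y, q x y) ≤ normOne p f := by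
  refine (summable_mul (support_reweight_finite hf)).tsum_le_tsum (fun x => ?_) (summable_mul hf)
  rcases eq_or_ne (∑' y, q x y) 0 with h0 | h0
  · rw [h0, zero_mul]
    exact mul_nonneg (hp.mass_nonneg x) (hf0 x)
  · rw [mul_div_cancel₀ _ h0]

lemma normSq_reweight_le (hp : IsNetwork p) (hpq : ∀ x, ∑' y, p x y ≤ ∑' y, q x y) {f : V → ℝ}
    (hf : f.support.Finite) :
    normSq q (fun x => (∑' y, p x y) * f x / ∑' y, q x y) ≤ normSq p f := by
  refine (summable_mul_sq (support_reweight_finite hf)).tsum_le_tsum (fun x => ?_)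
    (summable_mul_sq hf)
  have h1 := hp.mass_nonneg x
  rcases (h1.trans (hpq x)).eq_or_lt with h0 | h0
  · rw [← h0, zero_mul]
    exact mul_nonneg h1 (sq_nonneg _)
  · have e : (∑' y, q x y) * ((∑' y, p x y) * f x / ∑' y, q x y) ^ 2 =
        (∑' y, p x y) * f x ^ 2 * ((∑' y, p x y) / ∑' y, q x y) := by field_simp
    rw [e]
    exact mul_le_of_le_one_right (mul_nonneg h1 (sq_nonneg _)) ((div_le_one h0).2 (hpq x))

lemma tsum_mul_tsum_row {f g : V → ℝ} {A B : Finset V} (hf : ∀ x ∉ A, f x = 0)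
    (hg : ∀ x ∉ B, g x = 0) :
    ∑' x, f x * ∑' y, p x y * g y = ∑ x ∈ A, ∑ y ∈ B, f x * p x y * g y := by
  rw [tsum_eq_sum (s := A) fun x hx => by simp [hf x hx]]
  refine Finset.sum_congr rfl fun x _ => ?_
  rw [tsum_eq_sum (s := B) fun y hy => by simp [hg y hy], Finset.mul_sum]
  exact Finset.sum_congr rfl fun y _ => by ring

/-- Self-adjointness of the averaging operator. -/
lemma tsum_mul_avg_comm (h : IsNetwork p) {f g : V → ℝ} (hf : f.support.Finite)
    (hg : g.support.Finite) :
    ∑' x, (∑' y, p x y) * f x * avg p g x = ∑' x, (∑' y, p x y) * avg p f x * g x := by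
  have hf' : ∀ x ∉ hf.toFinset, f x = 0 := fun x hx => by simpa using hx
  have hg' : ∀ x ∉ hg.toFinset, g x = 0 := fun x hx => by simpa using hx
  have e1 : ∀ x, (∑' y, p x y) * f x * avg p g x = f x * ∑' y, p x y * g y := fun x => by
    rw [← h.mass_mul_avg]; ring
  have e2 : ∀ x, (∑' y, p x y) * avg p f x * g x = g x * ∑' y, p x y * f y := fun x => by
    rw [← h.mass_mul_avg]; ring
  simp only [e1, e2]
  rw [tsum_mul_tsum_row hf' hg', tsum_mul_tsum_row hg' hf', Finset.sum_comm]
  exact Finset.sum_congr rfl fun x _ => Finset.sum_congr rfl fun y _ => by rw [h.symm]; ring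

lemma sq_tsum_mul_le (h : IsNetwork p) {f g : V → ℝ} (hf : f.support.Finite)
    (hg : g.support.Finite) :
    (∑' x, (∑' y, p x y) * f x * g x) ^ 2 ≤ normSq p f * normSq p g := by
  classical
  have hf' : ∀ x ∉ hf.toFinset ∪ hg.toFinset, f x = 0 := fun x hx => by
    simp only [Finset.mem_union, Set.Finite.mem_toFinset, Function.mem_support] at hx
    tauto
  have hg' : ∀ x ∉ hf.toFinset ∪ hg.toFinset, g x = 0 := fun x hx => by
    simp only [Finset.mem_union, Set.Finite.mem_toFinset, Function.mem_support] at hx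
    tauto
  rw [normSq_eq f hf', normSq_eq g hg', tsum_eq_sum fun x hx => by rw [hf' x hx]; ring]
  exact Finset.sum_sq_le_sum_mul_sum_of_sq_le_mul _
    (fun x _ => mul_nonneg (h.mass_nonneg x) (sq_nonneg _))
    (fun x _ => mul_nonneg (h.mass_nonneg x) (sq_nonneg _)) fun x _ => le_of_eq (by ring)

end IsNetwork

section

variable {V : Type} {π : ℕ → V → V → ℝ}

lemma fCut_nonneg (hπ : ∀ t, IsNetwork (π t)) (u : ℕ) (A : Finset V) : 0 ≤ fCut π u A :=
  Finset.sum_nonneg fun a _ => tsum_nonneg fun b => by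
    split_ifs
    · exact le_rfl
    · exact (hπ u).nonneg a b

lemma fMass_nonneg (hπ : ∀ t, IsNetwork (π t)) (u : ℕ) (A : Finset V) : 0 ≤ fMass π u A :=
  Finset.sum_nonneg fun a _ => (hπ u).mass_nonneg a

lemma kappa_set_nonneg (hπ : ∀ t, IsNetwork (π t)) {d : ℝ} {u : ℕ} {r : ℝ}
    (hr : ∃ A : Finset V, A.Nonempty ∧ (∀ a ∈ A, 0 < vc π u a) ∧
      r = fCut π u A / fMass π u A ^ ((d - 1) / d)) : 0 ≤ r := by
  obtain ⟨A, -, -, rfl⟩ := hr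
  exact div_nonneg (fCut_nonneg hπ u A) (Real.rpow_nonneg (fMass_nonneg hπ u A) _)

lemma kappa_nonneg (hπ : ∀ t, IsNetwork (π t)) (d : ℝ) (u : ℕ) : 0 ≤ kappa π d u :=
  Real.sInf_nonneg fun _ hr => kappa_set_nonneg hπ hr

lemma kappa_le (hπ : ∀ t, IsNetwork (π t)) (d : ℝ) {u : ℕ} {A : Finset V} (hA : A.Nonempty)
    (hA0 : ∀ a ∈ A, 0 < vc π u a) :
    kappa π d u ≤ fCut π u A / fMass π u A ^ ((d - 1) / d) :=
  csInf_le ⟨0, fun _ hr => kappa_set_nonneg hπ hr⟩ ⟨A, hA, hA0, rfl⟩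

/-- The isoperimetric inequality for arbitrary finite sets of vertices. -/
lemma rpow_fMass_mul_kappa_le (hπ : ∀ t, IsNetwork (π t)) {d : ℝ} (hd : 1 < d) (u : ℕ)
    (A : Finset V) : fMass π u A ^ ((d - 1) / d) * kappa π d u ≤ fCut π u A := by
  classical
  set A' := A.filter fun a => 0 < vc π u a
  have h0 : ∀ a ∈ A, a ∉ A' → vc π u a = 0 := fun a ha ha' =>
    le_antisymm (not_lt.1 fun h => ha' (Finset.mem_filter.2 ⟨ha, h⟩)) ((hπ u).mass_nonneg a)
  have hmass : fMass π u A = fMass π u A' :=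
    (Finset.sum_subset (Finset.filter_subset _ _) h0).symm
  have hcut : fCut π u A' ≤ fCut π u A := by
    rw [fCut, fCut]
    refine le_trans (le_of_eq (Finset.sum_congr rfl fun a _ => tsum_congr fun b => ?_))
      (Finset.sum_le_sum_of_subset_of_nonneg (Finset.filter_subset _ _) fun a _ _ =>
        tsum_nonneg fun b => ?_)
    · by_cases hb : b ∈ A
      · by_cases hb' : b ∈ A'
        · rw [if_pos hb', if_pos hb]
        · rw [if_neg hb', if_pos hb, (hπ u).symm,
            (hπ u).eq_zero_of_mass_eq_zero (h0 b hb hb')]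
      · rw [if_neg hb, if_neg fun h => hb (Finset.filter_subset _ _ h)]
    · split_ifs
      · exact le_rfl
      · exact (hπ u).nonneg a b
  rw [hmass]
  refine le_trans ?_ hcut
  rcases A'.eq_empty_or_nonempty with hA | hA
  · rw [hA, fMass, Finset.sum_empty,
      Real.zero_rpow (div_ne_zero (by linarith) (by linarith)), zero_mul]
    exact fCut_nonneg hπ u _
  · have hpos : ∀ a ∈ A', 0 < vc π u a := fun a ha => (Finset.mem_filter.1 ha).2
    have hM : 0 < fMass π u A' := Finset.sum_pos hpos hA
    rw [mul_comm, ← le_div_iff₀ (Real.rpow_pos_of_pos hM _)]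
    exact kappa_le hπ d hA hpos

lemma kappa_sq_le (hπ : ∀ t, IsNetwork (π t)) {d L : ℝ} (hd : 1 < d) {u : ℕ} {x : V}
    (hx : 0 < vc π u x) (hL : vc π u x ≤ L) : kappa π d u ^ 2 ≤ L ^ (2 / d) := by
  have hd0 : 0 < d := by linarith
  have h1 := kappa_le hπ d (u := u) (A := {x}) (Finset.singleton_nonempty x) (by simpa using hx)
  have h2 : fCut π u {x} ≤ vc π u x := by
    rw [fCut, Finset.sum_singleton]
    refine Summable.tsum_le_tsum (fun b => ?_) ?_ ((hπ u).summable_row x)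
    · split_ifs
      · exact (hπ u).nonneg x b
      · exact le_rfl
    · refine summable_of_hasFiniteSupport (((hπ u).finite x).subset fun b hb => ?_)
      intro h
      simp [h] at hb
  have h3 : kappa π d u ≤ vc π u x ^ (1 / d) := by
    refine h1.trans ?_
    rw [fMass, Finset.sum_singleton, div_le_iff₀ (Real.rpow_pos_of_pos hx _),
      ← Real.rpow_add hx, ← add_div, add_sub_cancel, div_self hd0.ne', Real.rpow_one]
    exact h2
  calc kappa π d u ^ 2 ≤ (L ^ (1 / d)) ^ 2 := by
        refine pow_le_pow_left₀ (kappa_nonneg hπ d u) (h3.trans ?_) 2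
        exact Real.rpow_le_rpow hx.le hL (by positivity)
    _ = L ^ (2 / d) := by
        rw [← Real.rpow_natCast (L ^ (1 / d)), ← Real.rpow_mul (hx.le.trans hL)]
        congr 1
        push_cast
        ring

open Classical in
lemma Pn_zero (π : ℕ → V → V → ℝ) (s : ℕ) (x z : V) :
    Pn π s 0 x z = if x = z then 1 else 0 := rfl

lemma Pn_succ (hπ : ∀ t, IsNetwork (π t)) (n : ℕ) (x z : V) :
    Pn π 0 (n + 1) x z =
      (∑' w, π n z w) * avg (π n) (fun w => Pn π 0 n x w / vc π n w) z := by
  rw [(hπ n).mass_mul_avg, Pn]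
  refine tsum_congr fun w => ?_
  rw [step, zero_add, (hπ n).symm w z]
  ring

lemma Pn_eq_vc_mul (hπ : ∀ t, IsNetwork (π t)) (hmono : ∀ x : V, Monotone fun t => vc π t x)
    {x : V} (hx : 0 < vc π 0 x) (n : ℕ) (z : V) :
    Pn π 0 n x z = vc π n z * (Pn π 0 n x z / vc π n z) := by
  by_cases h0 : vc π n z = 0
  · rw [h0, zero_mul]
    cases n with
    | zero =>
      rw [Pn_zero, if_neg]
      rintro rfl
      exact hx.ne' h0
    | succ n =>
      have : ∑' w, π n z w = 0 :=
        le_antisymm (h0 ▸ hmono z n.le_succ) ((hπ n).mass_nonneg z)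
      rw [Pn_succ hπ, this, zero_mul]
  · rw [mul_div_cancel₀ _ h0]

/-- Bounds on the density of the walk started at `x`. -/
lemma forward_bounds (hπ : ∀ t, IsNetwork (π t)) (hmono : ∀ x : V, Monotone fun t => vc π t x)
    {γ : ℝ} (hγ0 : 0 < γ) (hγ : ∀ t x, γ * vc π t x ≤ π t x x) {d L : ℝ} (hd : 1 < d)
    (hL : 1 ≤ L) (x : V) (n : ℕ) :
    (∀ z, 0 ≤ Pn π 0 n x z / vc π n z) ∧
    (fun z => Pn π 0 n x z / vc π n z).support.Finite ∧
    normOne (π n) (fun z => Pn π 0 n x z / vc π n z) ≤ 1 ∧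
    normSq (π n) (fun z => Pn π 0 n x z / vc π n z) ^ (2 / d) *
      (γ / (4 * d) / (4 * L ^ 2) ^ (2 / d) * psi π d n) ≤ 1 := by
  induction n with
  | zero =>
    have hsupp : ∀ z ∉ ({x} : Finset V), Pn π 0 0 x z / vc π 0 z = 0 := fun z hz => by
      rw [Pn_zero, if_neg fun h => hz (by simp [h]), zero_div]
    refine ⟨fun z => div_nonneg ?_ ((hπ 0).mass_nonneg z), ?_, ?_, ?_⟩
    · rw [Pn_zero]
      split_ifs <;> norm_num
    · exact ({x} : Finset V).finite_toSet.subset fun z hz => by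
        by_contra h
        exact hz (hsupp z h)
    · rw [IsNetwork.normOne_eq _ hsupp, Finset.sum_singleton]
      simp only [Pn, if_true, one_div]
      exact mul_inv_le_one
    · simp [psi]
  | succ n ih =>
    obtain ⟨h0, hfin, h1, h2⟩ := ih
    set g : V → ℝ := fun z => Pn π 0 n x z / vc π n z
    have e : (fun z => Pn π 0 (n + 1) x z / vc π (n + 1) z) =
        fun z => (∑' w, π n z w) * avg (π n) g z / ∑' w, π (n + 1) z w := by
      funext z
      rw [Pn_succ hπ]
      rfl
    have hle : ∀ z, ∑' w, π n z w ≤ ∑' w, π (n + 1) z w := fun z => hmono z n.le_succ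
    have ha := (hπ n).support_avg_finite hfin
    have ha0 := (hπ n).avg_nonneg h0
    rw [e]
    refine ⟨fun z => ?_, IsNetwork.support_reweight_finite ha, ?_, ?_⟩
    · rw [congrFun e z]
      exact div_nonneg (mul_nonneg ((hπ n).mass_nonneg z) (ha0 z)) ((hπ (n + 1)).mass_nonneg z)
    · refine ((hπ n).normOne_reweight_le ha0 ha).trans ?_
      rwa [(hπ n).normOne_avg hfin]
    · have hψ : psi π d (n + 1) = psi π d n + kappa π d n ^ 2 := Finset.sum_range_succ _ _
      have hψ0 : 0 ≤ psi π d n := Finset.sum_nonneg fun _ _ => sq_nonneg _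
      have hd0 : 0 < d := by linarith
      have key := (hπ n).normSq_avg_rpow_mul_le hγ0 (hγ n) hd (kappa_nonneg hπ d n)
        (by linarith : 0 < L) (rpow_fMass_mul_kappa_le hπ hd n) h0 hfin (h1.trans hL)
        (mul_nonneg (by positivity) hψ0) h2
      rw [hψ, mul_add]
      refine le_trans (mul_le_mul_of_nonneg_right (Real.rpow_le_rpow
        ((hπ (n + 1)).normSq_nonneg _) ((hπ n).normSq_reweight_le hle ha) (by positivity))
        (by positivity)) key

/-- The transition probability `z ↦ P(n, z; n + k, y)`, by backward recursion. -/
def back (π : ℕ → V → V → ℝ) (y : V) : ℕ → ℕ → V → ℝ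
  | 0, _ => Set.indicator {y} 1
  | k + 1, n => avg (π n) (back π y k (n + 1))

/-- Bounds on the transition probability to `y`, as a function of the starting point. -/
lemma back_bounds (hπ : ∀ t, IsNetwork (π t)) (hmono : ∀ x : V, Monotone fun t => vc π t x)
    {γ : ℝ} (hγ0 : 0 < γ) (hγ : ∀ t x, γ * vc π t x ≤ π t x x) {d L : ℝ} (hd : 1 < d)
    (hL : 1 ≤ L) (hvc : ∀ t y, vc π t y ≤ L) (y : V) (k n : ℕ) :
    (∀ z, 0 ≤ back π y k n z) ∧
    (back π y k n).support.Finite ∧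
    normOne (π n) (back π y k n) ≤ L ∧
    normSq (π n) (back π y k n) ^ (2 / d) *
      (γ / (4 * d) / (4 * L ^ 2) ^ (2 / d) *
        ∑ i ∈ Finset.range k, kappa π d (n + i) ^ 2) ≤ 1 := by
  induction k generalizing n with
  | zero =>
    have hsupp : ∀ z ∉ ({y} : Finset V), back π y 0 n z = 0 := fun z hz => by
      simp [back, Finset.mem_singleton.not.1 hz]
    refine ⟨fun z => Set.indicator_nonneg (fun _ _ => zero_le_one) z, ?_, ?_, ?_⟩
    · exact ({y} : Finset V).finite_toSet.subset fun z hz => by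
        by_contra h
        exact hz (hsupp z h)
    · rw [IsNetwork.normOne_eq _ hsupp, Finset.sum_singleton]
      simp only [back, Set.indicator_of_mem (Set.mem_singleton y), Pi.one_apply, mul_one]
      exact hvc n y
    · simp
  | succ k ih =>
    obtain ⟨h0, hfin, h1, h2⟩ := ih (n + 1)
    have hle : ∀ z, ∑' w, π n z w ≤ ∑' w, π (n + 1) z w := fun z => hmono z n.le_succ
    have hd0 : 0 < d := by linarith
    have h1' := (IsNetwork.normOne_mono hle h0 hfin).trans h1
    have hS0 : 0 ≤ γ / (4 * d) / (4 * L ^ 2) ^ (2 / d) *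
        ∑ i ∈ Finset.range k, kappa π d (n + 1 + i) ^ 2 :=
      mul_nonneg (by positivity) (Finset.sum_nonneg fun _ _ => sq_nonneg _)
    have h2' := (mul_le_mul_of_nonneg_right (Real.rpow_le_rpow ((hπ n).normSq_nonneg _)
      (IsNetwork.normSq_mono hle hfin) (by positivity)) hS0).trans h2
    refine ⟨(hπ n).avg_nonneg h0, (hπ n).support_avg_finite hfin,
      by rwa [back, (hπ n).normOne_avg hfin], ?_⟩
    have hsum : ∑ i ∈ Finset.range (k + 1), kappa π d (n + i) ^ 2 =
        ∑ i ∈ Finset.range k, kappa π d (n + 1 + i) ^ 2 + kappa π d n ^ 2 := by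
      rw [Finset.sum_range_succ', add_zero]
      simp only [add_assoc, add_comm 1]
    rw [hsum, mul_add]
    exact (hπ n).normSq_avg_rpow_mul_le hγ0 (hγ n) hd (kappa_nonneg hπ d n)
      (by linarith) (rpow_fMass_mul_kappa_le hπ hd n) h0 hfin h1' hS0 h2'

lemma support_back_finite (hπ : ∀ t, IsNetwork (π t)) (y : V) (k n : ℕ) :
    (back π y k n).support.Finite := by
  induction k generalizing n with
  | zero => exact (Set.finite_singleton y).subset Set.support_indicator_subset
  | succ k ih => exact (hπ n).support_avg_finite (ih _)

lemma Pn_add (hπ : ∀ t, IsNetwork (π t)) (hmono : ∀ x : V, Monotone fun t => vc π t x)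
    {x : V} (hx : 0 < vc π 0 x) (hfin : ∀ n, (fun z => Pn π 0 n x z / vc π n z).support.Finite)
    (y : V) (k n : ℕ) :
    Pn π 0 (n + k) x y =
      ∑' z, (∑' w, π n z w) * (Pn π 0 n x z / vc π n z) * back π y k n z := by
  have e : ∀ n z, (∑' w, π n z w) * (Pn π 0 n x z / vc π n z) = Pn π 0 n x z := fun n z =>
    (Pn_eq_vc_mul hπ hmono hx n z).symm
  induction k generalizing n with
  | zero =>
    simp only [e]
    rw [tsum_eq_single y fun z hz => by simp [back, hz]]
    simp [back]
  | succ k ih =>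
    rw [← add_assoc, add_right_comm, ih, back,
      (hπ n).tsum_mul_avg_comm (hfin n) (support_back_finite hπ y k (n + 1))]
    exact tsum_congr fun z => by rw [e, Pn_succ hπ]

/-- Transition probabilities are at most one. -/
lemma Pn_le_one (hπ : ∀ t, IsNetwork (π t)) (hmono : ∀ x : V, Monotone fun t => vc π t x)
    {x : V} (hx : 0 < vc π 0 x) {n : ℕ} (h0 : ∀ z, 0 ≤ Pn π 0 n x z / vc π n z)
    (hfin : (fun z => Pn π 0 n x z / vc π n z).support.Finite)
    (h1 : normOne (π n) (fun z => Pn π 0 n x z / vc π n z) ≤ 1) (y : V) : Pn π 0 n x y ≤ 1 := by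
  refine le_trans ?_ h1
  rw [Pn_eq_vc_mul hπ hmono hx n y]
  exact (IsNetwork.summable_mul hfin).le_tsum y fun z _ =>
    mul_nonneg ((hπ n).mass_nonneg z) (h0 z)

lemma exists_psi_split (d : ℝ) {D : ℝ} (hD : ∀ u, kappa π d u ^ 2 ≤ D) {t : ℕ}
    (ht : 2 * D ≤ psi π d t) :
    ∃ n ≤ t, psi π d t / 4 ≤ psi π d n ∧ psi π d n ≤ 3 / 4 * psi π d t := by
  have ht0 : 0 ≤ psi π d t := Finset.sum_nonneg fun _ _ => sq_nonneg _
  have hex : ∃ n, psi π d t / 4 ≤ psi π d n := ⟨t, by linarith⟩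
  refine ⟨Nat.find hex, Nat.find_min' hex (by linarith), Nat.find_spec hex, ?_⟩
  rcases hn : Nat.find hex with _ | n
  · simp only [psi, Finset.range_zero, Finset.sum_empty]
    exact mul_nonneg (by norm_num) ht0
  · have h1 := Nat.find_min hex (m := n) (by omega)
    have h2 : psi π d (n + 1) = psi π d n + kappa π d n ^ 2 := Finset.sum_range_succ _ _
    linarith [hD n]

lemma le_rpow_of_rpow_mul_le {Y S d : ℝ} (hY : 0 ≤ Y) (hS : 0 < S) (hd : 0 < d)
    (h : Y ^ (2 / d) * S ≤ 1) : Y ≤ (1 / S) ^ (d / 2) := by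
  rw [← le_div_iff₀ hS] at h
  have := Real.rpow_le_rpow (Real.rpow_nonneg hY _) h (by positivity : 0 ≤ d / 2)
  rwa [← Real.rpow_mul hY, div_mul_div_cancel₀ hd.ne', div_self two_ne_zero,
    Real.rpow_one] at this

/-- The heat-kernel bound with the optimal exponent, for large values of `psi`. -/
lemma Pn_le_of_two_mul_le_psi (hπ : ∀ t, IsNetwork (π t))
    (hmono : ∀ x : V, Monotone fun t => vc π t x)
    {γ : ℝ} (hγ0 : 0 < γ) (hγ : ∀ t x, γ * vc π t x ≤ π t x x) {d L : ℝ} (hd : 1 < d)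
    (hL : 1 ≤ L) (hvc : ∀ t y, vc π t y ≤ L) {x : V} (hx : 0 < vc π 0 x) (y : V) {t : ℕ}
    (ht : 2 * L ^ (2 / d) ≤ psi π d t) :
    Pn π 0 t x y ≤
      (1 / (γ / (4 * d) / (4 * L ^ 2) ^ (2 / d) * (psi π d t / 4))) ^ (d / 2) := by
  have hd0 : 0 < d := by linarith
  have hL0 : 0 < L := by linarith
  have hfwd := forward_bounds hπ hmono hγ0 hγ hd hL x
  obtain ⟨n, hn, hn1, hn2⟩ := exists_psi_split (π := π) d
    (fun u => kappa_sq_le hπ hd (hx.trans_le (hmono x (Nat.zero_le u))) (hvc u x)) ht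
  obtain ⟨k, rfl⟩ := Nat.exists_eq_add_of_le hn
  have hψ : psi π d (n + k) = psi π d n + ∑ i ∈ Finset.range k, kappa π d (n + i) ^ 2 :=
    Finset.sum_range_add _ _ _
  obtain ⟨-, hf, -, h2⟩ := hfwd n
  obtain ⟨-, hb, -, h2'⟩ := back_bounds hπ hmono hγ0 hγ hd hL hvc y k n
  set c := γ / (4 * d) / (4 * L ^ 2) ^ (2 / d)
  have hc : 0 < c := by positivity
  have ht0 : 0 < psi π d (n + k) := lt_of_lt_of_le (by positivity) ht
  have hS : 0 < c * (psi π d (n + k) / 4) := by positivity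
  set g : V → ℝ := fun z => Pn π 0 n x z / vc π n z
  have hcs := (hπ n).sq_tsum_mul_le hf hb
  rw [← Pn_add hπ hmono hx (fun n => (hfwd n).2.1) y k n] at hcs
  have hY := (hπ n).normSq_nonneg g
  have hY' := (hπ n).normSq_nonneg (back π y k n)
  have b1 := le_rpow_of_rpow_mul_le hY hS hd0 (le_trans (by gcongr) h2)
  have b2 := le_rpow_of_rpow_mul_le hY' hS hd0
    (le_trans (mul_le_mul_of_nonneg_left (mul_le_mul_of_nonneg_left (by linarith) hc.le)
      (Real.rpow_nonneg hY' _)) h2')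
  refine le_of_sq_le_sq ?_ (by positivity)
  rw [sq (_ ^ _)]
  exact hcs.trans (mul_le_mul b1 b2 hY' (by positivity))

end

/-- The sub-optimal heat-kernel bound from the proof of Theorem 1.2: for a uniformly
`γ`-lazy walk with non-decreasing, uniformly bounded vertex conductances, for any
`α ∈ (0,1)` there is `C′ = C′(d,α,γ,C)` with `P(0,x;t,y) ≤ C′ ψ_d(t)^{−(1−α)d/2}`. -/
theorem suboptimal_heat_kernel_bound
    (d α γ C : ℝ) (hd : 1 < d) (hα : α ∈ Set.Ioo (0 : ℝ) 1)
    (hγ : γ ∈ Set.Ioc (0 : ℝ) (1 / 2)) :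
    ∃ c : ℝ, ∀ (V : Type) (_ : Countable V) (π : ℕ → V → V → ℝ),
      (∀ t x y, 0 ≤ π t x y) →
      (∀ t x y, π t x y = π t y x) →
      (∀ t x, {y | π t x y ≠ 0}.Finite) →
      -- non-decreasing vertex conductances
      (∀ x : V, Monotone fun t => vc π t x) →
      -- uniformly lazy
      (∀ t x, γ * vc π t x ≤ π t x x) →
      -- uniformly bounded vertex conductances
      (∀ t y, vc π t y ≤ C) →
      ∀ t : ℕ, 0 < psi π d t → ∀ x y : V, 0 < vc π 0 x →
      Pn π 0 t x y ≤ c * psi π d t ^ (-((1 - α) * d / 2)) := by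
  obtain ⟨hα0, hα1⟩ := hα
  obtain ⟨hγ0, -⟩ := hγ
  have hd0 : 0 < d := by linarith
  set L := max 1 C
  have hL : 1 ≤ L := le_max_left _ _
  have hL0 : 0 < L := by linarith
  set b := γ / (4 * d) / (4 * L ^ 2) ^ (2 / d)
  have hb : 0 < b := by positivity
  set e := (1 - α) * d / 2
  have he : 0 < e := by
    have : 0 < 1 - α := by linarith
    positivity
  refine ⟨(2 * L ^ (2 / d)) ^ e + (4 / b) ^ e,
    fun V _ π hnn hsymm hfin hmono hlazy hC t ht x y hx => ?_⟩
  have hπ : ∀ t, IsNetwork (π t) := fun t => ⟨hnn t, hsymm t, hfin t⟩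
  have hvc : ∀ t y, vc π t y ≤ L := fun t y => (hC t y).trans (le_max_right _ _)
  obtain ⟨h0, hfin, h1, -⟩ := forward_bounds hπ hmono hγ0 hlazy hd hL x t
  have hP1 := Pn_le_one hπ hmono hx h0 hfin h1 y
  have hP0 : 0 ≤ Pn π 0 t x y := by
    rw [Pn_eq_vc_mul hπ hmono hx]
    exact mul_nonneg ((hπ t).mass_nonneg y) (h0 y)
  set P := Pn π 0 t x y
  set Ψ := psi π d t
  have hneg : ∀ r : ℝ, 0 ≤ r → r ^ e * Ψ ^ (-e) = (r / Ψ) ^ e := fun r hr => by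
    rw [Real.rpow_neg ht.le, Real.div_rpow hr ht.le, div_eq_mul_inv]
  rw [add_mul, hneg _ (by positivity), hneg _ (by positivity)]
  rcases le_total Ψ (2 * L ^ (2 / d)) with hΨ | hΨ
  · exact le_add_of_le_of_nonneg
      (hP1.trans (Real.one_le_rpow ((one_le_div ht).2 hΨ) he.le)) (by positivity)
  · refine le_add_of_nonneg_of_le (by positivity) ?_
    have hP := Pn_le_of_two_mul_le_psi hπ hmono hγ0 hlazy hd hL hvc hx y hΨ
    calc P = P ^ (1 : ℝ) := (Real.rpow_one P).symm
      _ ≤ P ^ (1 - α) := Real.rpow_le_rpow_of_exponent_ge_of_imp hP0 hP1 (by linarith)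
          fun _ h => absurd h (by linarith)
      _ ≤ ((1 / (b * (Ψ / 4))) ^ (d / 2)) ^ (1 - α) :=
          Real.rpow_le_rpow hP0 hP (by linarith)
      _ = (4 / b / Ψ) ^ e := by
          rw [← Real.rpow_mul (by positivity)]
          congr 1
          · field_simp
          · ring

end TimeVaryingConductances
end
end

section
/- Fix d > 2 and C₂ > 0 and set φ(n) = (e + C₂·n)^{−d/2} for n ∈ ℕ. For each t ≥ 0 let N_t be a Poisson random variable with mean 2t. Then ∫₀^∞ E[φ(N_t)] dt < ∞; indeed ∫₀^∞ E[φ(N_t)] dt ≤ φ(0)·∫₀^∞ P(N_t ≤ t) dt + ∫₀^∞ (e + C₂·t)^{−d/2} dt, and both integrals on the right are finite. -/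
open MeasureTheory ProbabilityTheory

noncomputable section

/-- `φ(n) = (e + C₂ n)^{−d/2}`. -/
def phi (d C₂ : ℝ) (n : ℕ) : ℝ := (Real.exp 1 + C₂ * n) ^ (-(d / 2))

/-- `E[φ(N_t)]` where `N_t` is Poisson of mean `2t`. -/
def poissonExp (d C₂ t : ℝ) : ℝ :=
  ∑' n : ℕ, poissonPMFReal (Real.toNNReal (2 * t)) n * phi d C₂ n

open Classical in
/-- `P(N_t ≤ t)` where `N_t` is Poisson of mean `2t`. -/
def poissonTail (t : ℝ) : ℝ :=
  ∑' n : ℕ, if (n : ℝ) ≤ t then poissonPMFReal (Real.toNNReal (2 * t)) n else 0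

set_option linter.deprecated false

lemma hasSum_poissonPMFReal (r : NNReal) : HasSum (poissonPMFReal r) 1 :=
  hasSum_one_poissonMeasure r

lemma summable_ite_poissonPMFReal (r : NNReal) (p : ℕ → Prop) [DecidablePred p] :
    Summable fun n ↦ if p n then poissonPMFReal r n else 0 := by
  refine Summable.of_nonneg_of_le (fun n ↦ ?_) (fun n ↦ ?_) (hasSum_poissonPMFReal r).summable
  all_goals split_ifs <;> simp [poissonPMFReal_nonneg]

/-- The Chernoff bound `P(N_t ≤ t) ≤ (2 / e) ^ t`. -/
lemma poissonTail_le_exp {t : ℝ} (ht : 0 ≤ t) :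
    poissonTail t ≤ Real.exp ((Real.log 2 - 1) * t) := by
  have h := (hasSum_poissonPMFReal t.toNNReal).mul_left (Real.exp ((Real.log 2 - 1) * t))
  rw [mul_one] at h
  rw [← h.tsum_eq]
  refine Summable.tsum_le_tsum (fun n ↦ ?_) (summable_ite_poissonPMFReal _ _) h.summable
  split_ifs with hn
  · have h_pow : (2 : ℝ) ^ n ≤ Real.exp (Real.log 2 * t) := by
      rw [← Real.rpow_natCast, Real.rpow_def_of_pos two_pos]
      have := Real.log_nonneg one_le_two
      gcongr
    have h_exp : Real.exp ((Real.log 2 - 1) * t) * Real.exp (-t)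
        = Real.exp (-(2 * t)) * Real.exp (Real.log 2 * t) := by
      rw [← Real.exp_add, ← Real.exp_add]
      ring_nf
    simp only [poissonPMFReal, Real.coe_toNNReal t ht,
      Real.coe_toNNReal (2 * t) (by positivity)]
    rw [← mul_div_assoc, ← mul_assoc, h_exp, mul_pow, mul_assoc]
    gcongr
  · exact mul_nonneg (Real.exp_nonneg _) poissonPMFReal_nonneg

lemma lintegral_poissonTail_lt_top :
    (∫⁻ t in Set.Ici (0 : ℝ), ENNReal.ofReal (poissonTail t)) < ⊤ := by
  have h_neg : Real.log 2 - 1 < 0 := by linarith [Real.log_two_lt_d9]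
  have h_int : IntegrableOn (fun t : ℝ ↦ Real.exp ((Real.log 2 - 1) * t)) (Set.Ici 0) := by
    rw [integrableOn_Ici_iff_integrableOn_Ioi]
    exact integrableOn_exp_mul_Ioi h_neg 0
  refine lt_of_le_of_lt (setLIntegral_mono' measurableSet_Ici fun t ht ↦ ?_)
    h_int.lintegral_lt_top
  exact ENNReal.ofReal_le_ofReal (poissonTail_le_exp ht)

lemma lintegral_add_mul_rpow_lt_top {d C₂ : ℝ} (hd : 2 < d) (hC₂ : 0 < C₂) :
    (∫⁻ t in Set.Ici (0 : ℝ), ENNReal.ofReal ((Real.exp 1 + C₂ * t) ^ (-(d / 2)))) < ⊤ := by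
  have h_pos : 0 < Real.exp 1 / C₂ := by positivity
  have h_int : IntegrableOn (fun t : ℝ ↦ C₂ ^ (-(d / 2)) * (t + Real.exp 1 / C₂) ^ (-(d / 2)))
      (Set.Ici 0) := by
    rw [integrableOn_Ici_iff_integrableOn_Ioi]
    exact (integrableOn_add_rpow_Ioi_of_lt (by linarith) (by linarith)).const_mul _
  refine lt_of_le_of_lt (setLIntegral_mono' measurableSet_Ici fun t ht ↦ le_of_eq ?_)
    h_int.lintegral_lt_top
  have ht : 0 ≤ t := ht
  rw [← Real.mul_rpow hC₂.le (by positivity)]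
  congr 2
  field_simp
  ring

lemma poissonExp_le {d C₂ t : ℝ} (hd : 0 ≤ d) (hC₂ : 0 ≤ C₂) (ht : 0 ≤ t) :
    poissonExp d C₂ t ≤
      phi d C₂ 0 * poissonTail t + (Real.exp 1 + C₂ * t) ^ (-(d / 2)) := by
  classical
  set r := Real.toNNReal (2 * t)
  have h_anti {x y : ℝ} (hx : 0 ≤ x) (hxy : x ≤ y) :
      (Real.exp 1 + C₂ * y) ^ (-(d / 2)) ≤ (Real.exp 1 + C₂ * x) ^ (-(d / 2)) :=
    Real.rpow_le_rpow_of_nonpos (by positivity) (by gcongr) (by linarith)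
  have h_phi_nonneg (n : ℕ) : 0 ≤ phi d C₂ n := by unfold phi; positivity
  have h_phi_le (n : ℕ) : phi d C₂ n ≤ phi d C₂ 0 := h_anti (by simp) (by simp)
  have h_tail : HasSum (fun n : ℕ ↦ if (n : ℝ) ≤ t then poissonPMFReal r n else 0)
      (poissonTail t) := by
    rw [poissonTail]
    convert (summable_ite_poissonPMFReal r fun n ↦ (n : ℝ) ≤ t).hasSum
  have h_sum := (h_tail.mul_left (phi d C₂ 0)).add
    ((hasSum_poissonPMFReal r).mul_right ((Real.exp 1 + C₂ * t) ^ (-(d / 2))))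
  rw [one_mul] at h_sum
  have h_summable : Summable fun n ↦ poissonPMFReal r n * phi d C₂ n :=
    Summable.of_nonneg_of_le (fun n ↦ mul_nonneg poissonPMFReal_nonneg (h_phi_nonneg n))
      (fun n ↦ mul_le_mul_of_nonneg_left (h_phi_le n) poissonPMFReal_nonneg)
      ((hasSum_poissonPMFReal r).summable.mul_right _)
  refine hasSum_le (fun n ↦ ?_) h_summable.hasSum h_sum
  have hp : 0 ≤ poissonPMFReal r n := poissonPMFReal_nonneg
  split_ifs with hn
  · rw [mul_comm]
    exact le_add_of_le_of_nonneg (mul_le_mul_of_nonneg_right (h_phi_le n) hp) (by positivity)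
  · rw [mul_zero, zero_add]
    exact mul_le_mul_of_nonneg_left (h_anti ht (not_le.1 hn).le) hp

lemma lintegral_poissonExp_le {d C₂ : ℝ} (hd : 0 ≤ d) (hC₂ : 0 ≤ C₂) :
    ∫⁻ t in Set.Ici (0 : ℝ), ENNReal.ofReal (poissonExp d C₂ t) ≤
      ENNReal.ofReal (phi d C₂ 0) *
          (∫⁻ t in Set.Ici (0 : ℝ), ENNReal.ofReal (poissonTail t)) +
        ∫⁻ t in Set.Ici (0 : ℝ), ENNReal.ofReal ((Real.exp 1 + C₂ * t) ^ (-(d / 2))) := by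
  rw [← lintegral_const_mul' _ _ ENNReal.ofReal_ne_top, ← lintegral_add_right _ (by fun_prop)]
  refine setLIntegral_mono' measurableSet_Ici fun t ht ↦ ?_
  rw [← ENNReal.ofReal_mul (by unfold phi; positivity)]
  exact (ENNReal.ofReal_le_ofReal (poissonExp_le hd hC₂ ht)).trans ENNReal.ofReal_add_le

/-- The integral estimate (3.2) from the proof of Proposition 1.8 of
Dembo–Huang–Morris–Peres: for `d > 2` and `C₂ > 0`, with `φ(n) = (e + C₂ n)^{−d/2}`
and `N_t` Poisson of mean `2t`, one has
`∫₀^∞ E[φ(N_t)] dt ≤ φ(0) ∫₀^∞ P(N_t ≤ t) dt + ∫₀^∞ (e + C₂ t)^{−d/2} dt`,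
both right-hand integrals are finite, and hence so is the left-hand one. -/
theorem poisson_integral_finite (d C₂ : ℝ) (hd : 2 < d) (hC₂ : 0 < C₂) :
    (∫⁻ t in Set.Ici (0 : ℝ), ENNReal.ofReal (poissonExp d C₂ t) ≤
      ENNReal.ofReal (phi d C₂ 0) *
          (∫⁻ t in Set.Ici (0 : ℝ), ENNReal.ofReal (poissonTail t)) +
        ∫⁻ t in Set.Ici (0 : ℝ), ENNReal.ofReal ((Real.exp 1 + C₂ * t) ^ (-(d / 2)))) ∧
    (∫⁻ t in Set.Ici (0 : ℝ), ENNReal.ofReal (poissonTail t)) < ⊤ ∧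
    (∫⁻ t in Set.Ici (0 : ℝ), ENNReal.ofReal ((Real.exp 1 + C₂ * t) ^ (-(d / 2)))) < ⊤ ∧
    (∫⁻ t in Set.Ici (0 : ℝ), ENNReal.ofReal (poissonExp d C₂ t)) < ⊤ := by
  have h_tail := lintegral_poissonTail_lt_top
  have h_rpow := lintegral_add_mul_rpow_lt_top hd hC₂
  refine ⟨?_, h_tail, h_rpow, ?_⟩
  · exact lintegral_poissonExp_le (by linarith) hC₂.le
  · exact (lintegral_poissonExp_le (by linarith) hC₂.le).trans_lt
      (ENNReal.add_lt_top.2 ⟨ENNReal.mul_lt_top ENNReal.ofReal_lt_top h_tail, h_rpow⟩)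
end
end

section
/- Fix d > 1, k ∈ ℝ, c > 0, non-negative reals (κ_i)_{0≤i<r}, and set f(z) = max((z/2)^{4/d}, e^{−2k/d}) for z > 0. Suppose (l_i)_{0≤i≤r} are positive reals satisfying l_{i+1} ≤ l_i·exp(−c·κ_i²·f(l_i)) for all 0 ≤ i < r. Then c·Σ_{i=0}^{r−1} κ_i² ≤ ∫_{l_r}^{∞} min(2^{4/d}·z^{−1−4/d}, e^{2k/d}·z^{−1}) dz. -/
open MeasureTheory

theorem integrableOn_Ioi_min_rpow_inv {p a A B : ℝ} (hp : 0 < p) (ha : 0 < a) (hA : 0 ≤ A)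
    (hB : 0 ≤ B) :
    IntegrableOn (fun z : ℝ => min (A * z ^ (-(1 + p))) (B * z⁻¹)) (Set.Ioi a) := by
  have h : IntegrableOn (fun z : ℝ => A * z ^ (-(1 + p))) (Set.Ioi a) :=
    (integrableOn_Ioi_rpow_of_lt (by linarith) ha).const_mul A
  refine Integrable.mono' h ?_ ?_
  · exact Measurable.aestronglyMeasurable (by fun_prop)
  · filter_upwards [ae_restrict_mem measurableSet_Ioi] with z hz
    have hz0 : 0 < z := ha.trans hz
    rw [Real.norm_of_nonneg (le_min (by positivity) (by positivity))]
    exact min_le_left _ _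

theorem inv_max_mul_inv_le_min {p q z b : ℝ} (hp : 0 < p) (hz : 0 < z) (hzb : z ≤ b) :
    (max ((b / 2) ^ p) (Real.exp (-q)))⁻¹ * z⁻¹ ≤
      min ((2 : ℝ) ^ p * z ^ (-(1 + p))) (Real.exp q * z⁻¹) := by
  refine le_min ?_ ?_
  · have heq : (2 : ℝ) ^ p * z ^ (-(1 + p)) = ((z / 2) ^ p)⁻¹ * z⁻¹ := by
      rw [Real.rpow_neg hz.le, Real.rpow_add hz, Real.rpow_one, Real.div_rpow hz.le zero_le_two]
      field_simp
    rw [heq]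
    gcongr
    exact (Real.rpow_le_rpow (by positivity) (by linarith) hp.le).trans (le_max_left _ _)
  · have heq : Real.exp q = (Real.exp (-q))⁻¹ := by rw [Real.exp_neg, inv_inv]
    rw [heq]
    gcongr
    exact le_max_right _ _

/-- If `1 / (z F) ≤ g z` on `(a, b]` and `a ≤ b exp (-x F)`, then `x ≤ ∫ g` over `(a, b]`. -/
theorem le_setIntegral_Ioc_of_le_mul_exp {g : ℝ → ℝ} {a b x F : ℝ} (ha : 0 < a) (hb : 0 < b)
    (hF : 0 < F) (hx : 0 ≤ x) (hab : a ≤ b * Real.exp (-(x * F)))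
    (hg : IntegrableOn g (Set.Ioc a b)) (hle : ∀ z ∈ Set.Ioc a b, F⁻¹ * z⁻¹ ≤ g z) :
    x ≤ ∫ z in Set.Ioc a b, g z := by
  have hab' : a ≤ b :=
    hab.trans (mul_le_of_le_one_right hb.le (Real.exp_le_one_iff.2 
      (neg_nonpos.2 (mul_nonneg hx hF.le))))
  have hlog : x * F ≤ Real.log (b / a) := by
    have h := Real.log_le_log ha hab
    rw [Real.log_mul hb.ne' (Real.exp_ne_zero _), Real.log_exp] at h
    rw [Real.log_div hb.ne' ha.ne']
    linarith
  have h0 : (0 : ℝ) ∉ Set.uIcc a b := Set.notMem_uIcc_of_lt ha hb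
  have hint : IntegrableOn (fun z : ℝ => F⁻¹ * z⁻¹) (Set.Ioc a b) :=
    (((intervalIntegrable_inv_iff.2 (Or.inr h0)).const_mul F⁻¹).1)
  calc x = F⁻¹ * (x * F) := by field_simp
    _ ≤ F⁻¹ * Real.log (b / a) := by gcongr
    _ = ∫ z in Set.Ioc a b, F⁻¹ * z⁻¹ := by
      rw [← intervalIntegral.integral_of_le hab', intervalIntegral.integral_const_mul,
        integral_inv h0]
    _ ≤ ∫ z in Set.Ioc a b, g z := setIntegral_mono_on hint hg measurableSet_Ioc hle

/-- Inequality (2.24) of Dembo–Huang–Morris–Peres, summed: if positive `l_i` satisfy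
`l_{i+1} ≤ l_i exp(−c κ_i² f(l_i))` with `f(z) = max((z/2)^{4/d}, e^{−2k/d})`, then
`c ∑_{i<r} κ_i² ≤ ∫_{l_r}^∞ min(2^{4/d} z^{−1−4/d}, e^{2k/d} z^{−1}) dz`. -/
theorem sum_kappa_le_integral (d k c : ℝ) (hd : 1 < d) (hc : 0 < c) (r : ℕ)
    (κ : ℕ → ℝ) (hκ : ∀ i, 0 ≤ κ i)
    (l : ℕ → ℝ) (hl : ∀ i ≤ r, 0 < l i)
    (hrec : ∀ i < r, l (i + 1) ≤ l i *
      Real.exp (-(c * κ i ^ 2 * max ((l i / 2) ^ (4 / d)) (Real.exp (-(2 * k / d)))))) :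
    c * ∑ i ∈ Finset.range r, κ i ^ 2 ≤
      ∫ z in Set.Ioi (l r),
        min ((2 : ℝ) ^ (4 / d) * z ^ (-(1 + 4 / d))) (Real.exp (2 * k / d) * z⁻¹) := by
  induction r with
  | zero =>
    have hl0 := hl 0 le_rfl
    simp only [Finset.range_zero, Finset.sum_empty, mul_zero]
    refine setIntegral_nonneg measurableSet_Ioi fun z hz => ?_
    have hz0 : 0 < z := hl0.trans hz
    exact le_min (by positivity) (by positivity)
  | succ n ih =>
    have hp : 0 < 4 / d := by positivity
    have ha := hl (n + 1) le_rfl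
    have hb := hl n n.le_succ
    have hab := hrec n n.lt_succ_self
    have hF : 0 < max ((l n / 2) ^ (4 / d)) (Real.exp (-(2 * k / d))) :=
      lt_max_of_lt_right (Real.exp_pos _)
    have hx : 0 ≤ c * κ n ^ 2 := by positivity
    have hle : l (n + 1) ≤ l n := hab.trans (mul_le_of_le_one_right hb.le
      (Real.exp_le_one_iff.2 (neg_nonpos.2 (mul_nonneg hx hF.le))))
    have hint := integrableOn_Ioi_min_rpow_inv (A := (2 : ℝ) ^ (4 / d))
      (B := Real.exp (2 * k / d)) hp ha (by positivity) (by positivity)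
    rw [Finset.sum_range_succ, mul_add, ← Set.Ioc_union_Ioi_eq_Ioi hle,
      setIntegral_union (Set.Ioc_disjoint_Ioi le_rfl) measurableSet_Ioi
        (hint.mono_set Set.Ioc_subset_Ioi_self) (hint.mono_set (Set.Ioi_subset_Ioi hle)), add_comm]
    exact add_le_add
      (le_setIntegral_Ioc_of_le_mul_exp ha hb hF hx hab
        (hint.mono_set Set.Ioc_subset_Ioi_self)
        fun z hz => inv_max_mul_inv_le_min hp (ha.trans hz.1) hz.2)
      (ih (fun i hi => hl i (hi.trans n.le_succ)) fun i hi => hrec i (hi.trans n.lt_succ_self))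
end
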